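/- For all integers n ≥ 5 and p ≥ 0, (Σ_{i=0}^{p} C(p,i) B_{n+i−1}) · (Σ_{j=1}^{n−1} (−1)^{j+1} Σ_{i=0}^{p} C(p,i) B_{n+i−j+1}) > (Σ_{i=0}^{p} C(p,i) B_{n+i}) · (Σ_{j=1}^{n−1} (−1)^{j+1} Σ_{i=0}^{p} C(p,i) B_{n+i−j}), where C(p,i) is the binomial coefficient and B_k is the k-th Bell number, and the inequality is between integers. -/

import Mathlib

open Finset SimpleGraph

/-- A coloring partition of `G`: a partition of the vertex set into (nonempty)
independent (stable) sets. -/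
def IsStablePartition {V : Type*} [Fintype V] [DecidableEq V] (G : SimpleGraph V)
    (P : Finpartition (univ : Finset V)) : Prop :=
  ∀ t ∈ P.parts, ∀ u ∈ t, ∀ v ∈ t, ¬ G.Adj u v

open scoped Classical in
/-- `colB G` : the number of coloring partitions of `G`. -/
noncomputable def colB {V : Type*} [Fintype V] [DecidableEq V] (G : SimpleGraph V) : ℕ :=
  (univ.filter (IsStablePartition G)).card

open scoped Classical in
/-- `colT G` : the total number of blocks summed over all coloring partitions of `G`. -/
noncomputable def colT {V : Type*} [Fintype V] [DecidableEq V] (G : SimpleGraph V) : ℕ :=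
  ∑ P ∈ univ.filter (IsStablePartition G), P.parts.card

/-- `colA G = colT G / colB G` : the average number of blocks. -/
noncomputable def colA {V : Type*} [Fintype V] [DecidableEq V] (G : SimpleGraph V) : ℚ :=
  (colT G : ℚ) / (colB G : ℚ)

/-- The `n`-th Bell number: the number of partitions of an `n`-element set. -/
noncomputable def bell (n : ℕ) : ℕ :=
  Fintype.card (Finpartition (univ : Finset (Fin n)))

/-- The disjoint union of `G` with `p` isolated vertices (`G ∪ pK₁`). -/
def unionIsolated {V : Type*} (G : SimpleGraph V) (p : ℕ) : SimpleGraph (V ⊕ Fin p) :=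
  SimpleGraph.fromRel (fun x y => ∃ a b, x = Sum.inl a ∧ y = Sum.inl b ∧ G.Adj a b)

/-- `Hgraph n r` : the graph obtained from the disjoint union of the cycle `C_n` and the
path `P_r` by adding an edge between one endpoint of the path (vertex `0`) and one vertex
of the cycle (vertex `0`). -/
def Hgraph (n r : ℕ) : SimpleGraph (Fin n ⊕ Fin r) :=
  SimpleGraph.fromRel (fun x y =>
    (∃ a b, x = Sum.inl a ∧ y = Sum.inl b ∧ (cycleGraph n).Adj a b) ∨
    (∃ a b, x = Sum.inr a ∧ y = Sum.inr b ∧ (pathGraph r).Adj a b) ∨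
    (∃ (a : Fin n) (b : Fin r), a.val = 0 ∧ b.val = 0 ∧ x = Sum.inl a ∧ y = Sum.inr b))

/-- A function is determined by the partition into its fibres and an injection of the blocks. -/
lemma Finpartition.bijective_sigma_embedding (α β : Type*) [Fintype α] [DecidableEq α] :
    Function.Bijective
      (fun (x : Σ P : Finpartition (univ : Finset α), (P.parts ↪ β)) (a : α) =>
        x.2 ⟨x.1.part a, x.1.part_mem.2 (mem_univ a)⟩) := by
  classical
  constructor
  · rintro ⟨P, g⟩ ⟨P', g'⟩ h
    have hpart : ∀ a, P.part a = P'.part a := by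
      intro a
      ext b
      rw [P.mem_part_iff_part_eq_part (mem_univ b) (mem_univ a),
        P'.mem_part_iff_part_eq_part (mem_univ b) (mem_univ a)]
      have hb := congrFun h b
      have ha := congrFun h a
      dsimp only at ha hb
      constructor
      · intro e
        have : g' ⟨P'.part b, P'.part_mem.2 (mem_univ b)⟩ =
            g' ⟨P'.part a, P'.part_mem.2 (mem_univ a)⟩ := by
          rw [← ha, ← hb]; congr 2
        exact congrArg Subtype.val (g'.injective this)
      · intro e
        have : g ⟨P.part b, P.part_mem.2 (mem_univ b)⟩ =
            g ⟨P.part a, P.part_mem.2 (mem_univ a)⟩ := by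
          rw [ha, hb]; congr 2
        exact congrArg Subtype.val (g.injective this)
    obtain rfl : P = P' := by
      ext t
      constructor
      · intro ht
        obtain ⟨a, ha⟩ := P.nonempty_of_mem_parts ht
        rw [← P.part_eq_of_mem ht ha, hpart]
        exact P'.part_mem.2 (mem_univ a)
      · intro ht
        obtain ⟨a, ha⟩ := P'.nonempty_of_mem_parts ht
        rw [← P'.part_eq_of_mem ht ha, ← hpart]
        exact P.part_mem.2 (mem_univ a)
    congr 1
    ext ⟨t, ht⟩
    obtain ⟨a, ha⟩ := P.nonempty_of_mem_parts ht
    obtain rfl := P.part_eq_of_mem ht ha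
    exact congrFun h a
  · intro f
    let P := Finpartition.ofSetoid (Setoid.ker f)
    have hmem : ∀ a b, b ∈ P.part a ↔ f a = f b := fun a b =>
      Finpartition.mem_part_ofSetoid_iff_rel
    have hf : ∀ t : P.parts, ∀ a ∈ t.1,
        f (P.nonempty_of_mem_parts t.2).choose = f a := by
      intro t a ha
      have h : ∀ c ∈ t.1, f c = f a := by
        intro c hc
        rw [← P.part_eq_of_mem t.2 ha, hmem] at hc
        exact hc.symm
      exact h _ (P.nonempty_of_mem_parts t.2).choose_spec
    refine ⟨⟨P, fun t => f (P.nonempty_of_mem_parts t.2).choose, fun s t hst => ?_⟩, ?_⟩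
    · obtain ⟨a, ha⟩ := P.nonempty_of_mem_parts s.2
      obtain ⟨b, hb⟩ := P.nonempty_of_mem_parts t.2
      dsimp only at hst
      rw [hf s a ha, hf t b hb, ← hmem,
        P.mem_part_iff_part_eq_part (mem_univ b) (mem_univ a)] at hst
      apply Subtype.ext
      rw [← P.part_eq_of_mem s.2 ha, ← P.part_eq_of_mem t.2 hb, hst]
    · funext a
      exact hf ⟨P.part a, P.part_mem.2 (mem_univ a)⟩ a (P.mem_part (mem_univ a))

lemma pow_eq_sum_descFactorial (n m : ℕ) :
    m ^ n = ∑ P : Finpartition (univ : Finset (Fin n)), m.descFactorial P.parts.card := by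
  have h := Fintype.card_congr
    (Equiv.ofBijective _ (Finpartition.bijective_sigma_embedding (Fin n) (Fin m)))
  simpa [Fintype.card_sigma] using h.symm

lemma hasSum_descFactorial_div_factorial (k : ℕ) :
    HasSum (fun x : ℕ => (x.descFactorial k : ℝ) / x.factorial) (Real.exp 1) := by
  have h : HasSum (fun x : ℕ => (1 : ℝ) / x.factorial) (Real.exp 1) := by
    simpa [Real.exp_eq_exp_ℝ] using NormedSpace.expSeries_div_hasSum_exp (1 : ℝ)
  rw [← hasSum_nat_add_iff' k]
  have h0 : ∑ x ∈ range k, (x.descFactorial k : ℝ) / x.factorial = 0 :=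
    sum_eq_zero fun x hx => by
      rw [Nat.descFactorial_eq_zero_iff_lt.2 (mem_range.1 hx)]; simp
  rw [h0, sub_zero]
  refine h.congr_fun ?_
  intro x
  have := Nat.factorial_mul_descFactorial (Nat.le_add_left k x)
  rw [Nat.add_sub_cancel] at this
  rw [← this]
  have h1 : ((x + k).descFactorial k : ℝ) ≠ 0 := by
    simp [Nat.descFactorial_eq_zero_iff_lt]
  have h2 : (x.factorial : ℝ) ≠ 0 := by positivity
  push_cast
  field_simp

/-- Dobiński's formula. -/
lemma hasSum_pow_div_factorial (n : ℕ) :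
    HasSum (fun x : ℕ => (x : ℝ) ^ n / x.factorial) (Real.exp 1 * bell n) := by
  have h := hasSum_sum (s := univ) fun (P : Finpartition (univ : Finset (Fin n))) _ =>
    hasSum_descFactorial_div_factorial P.parts.card
  convert! h using 1
  · funext x
    rw [← sum_div]
    exact_mod_cast congrArg (fun y : ℕ => (y : ℝ) / x.factorial) (pow_eq_sum_descFactorial n x)
  · simp [bell, mul_comm]

/-- The form whose positivity is to be shown, evaluated at a moment sequence `m`. -/
def momentForm (ε : ℝ) (q : ℕ) (m : ℕ → ℝ) : ℝ :=
  m (q + 1) * m (q + 3) - m (q + 2) ^ 2 +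
    ε * ((m (q + 1) + m (q + 2)) * m 2 - (m (q + 2) + m (q + 3)) * m 1)

/-- The contribution to `momentForm` of a pair of atoms `x`, `y`. -/
def momentKernel (ε : ℝ) (q : ℕ) (x y : ℝ) : ℝ :=
  x * y * (x - y) * (x ^ q * y ^ q * (x - y) + ε * (y ^ q * (1 + y) - x ^ q * (1 + x)))

/-- The `k`-th moment of the weight `w` restricted to `{0, …, N - 1}`. -/
def partialMoment (w : ℕ → ℝ) (N k : ℕ) : ℝ := ∑ x ∈ range N, (x : ℝ) ^ k * w x

lemma momentForm_partialMoment_succ (ε : ℝ) (q : ℕ) (w : ℕ → ℝ) (N : ℕ) :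
    momentForm ε q (partialMoment w (N + 1)) = momentForm ε q (partialMoment w N) +
      w N * ∑ y ∈ range N, w y * momentKernel ε q N y := by
  have hsum : ∑ y ∈ range N, w y * momentKernel ε q N y =
      (N : ℝ) ^ (q + 1) * partialMoment w N (q + 3) + (N : ℝ) ^ (q + 3) * partialMoment w N (q + 1)
      - 2 * (N : ℝ) ^ (q + 2) * partialMoment w N (q + 2)
      + ε * (((N : ℝ) ^ (q + 1) + (N : ℝ) ^ (q + 2)) * partialMoment w N 2
        + (N : ℝ) ^ 2 * (partialMoment w N (q + 1) + partialMoment w N (q + 2))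
        - ((N : ℝ) ^ (q + 2) + (N : ℝ) ^ (q + 3)) * partialMoment w N 1
        - N * (partialMoment w N (q + 2) + partialMoment w N (q + 3))) := by
    simp only [partialMoment, mul_sum, ← sum_add_distrib, ← sum_sub_distrib]
    refine sum_congr rfl fun y _ => ?_
    unfold momentKernel
    ring
  have hsucc : ∀ k, partialMoment w (N + 1) k = partialMoment w N k + (N : ℝ) ^ k * w N :=
    fun k => sum_range_succ _ _
  rw [hsum]
  simp only [momentForm, hsucc]
  ring

lemma momentKernel_neg_one_nonneg (q x y : ℕ) (hxy : y ≤ x) :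
    0 ≤ momentKernel (-1) q x y := by
  have h : (y : ℝ) ≤ x := by exact_mod_cast hxy
  have h1 : (y : ℝ) ^ q * (1 + y) ≤ (x : ℝ) ^ q * (1 + x) := by gcongr
  have h2 : (0 : ℝ) ≤ x - y := sub_nonneg.2 h
  have h3 : (0 : ℝ) ≤ (x : ℝ) ^ q * (y : ℝ) ^ q * (x - y) := by positivity
  unfold momentKernel
  refine mul_nonneg (by positivity) (by linarith)

lemma momentKernel_one_nonneg (q x y : ℕ) (hq : 4 ≤ q) (hy : 2 ≤ y) (hxy : y < x) :
    0 ≤ momentKernel 1 q x y := by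
  have h2 : (2 : ℝ) ≤ y := by exact_mod_cast hy
  have h : (y : ℝ) + 1 ≤ x := by exact_mod_cast hxy
  have h3 : (0 : ℝ) ≤ x - y := by linarith
  have hpow : (y : ℝ) + 2 ≤ (y : ℝ) ^ q := by
    calc (y : ℝ) + 2 ≤ (y : ℝ) ^ 4 := by nlinarith [pow_le_pow_left₀ (by norm_num) h2 3]
      _ ≤ (y : ℝ) ^ q := pow_le_pow_right₀ (by linarith) hq
  have key : 1 + (x : ℝ) ≤ (y : ℝ) ^ q * (x - y) := by
    nlinarith [mul_le_mul_of_nonneg_right hpow h3]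
  have h4 := mul_le_mul_of_nonneg_left key (by positivity : (0 : ℝ) ≤ (x : ℝ) ^ q)
  have h5 : (0 : ℝ) ≤ (y : ℝ) ^ q * (1 + y) := by positivity
  unfold momentKernel
  refine mul_nonneg (by positivity) (by linarith)

lemma momentKernel_one_one_add_two_nonneg (q x : ℕ) (hq : 4 ≤ q) (hx : 3 ≤ x) :
    0 ≤ 3 * momentKernel 1 q x 1 + momentKernel 1 q x 2 := by
  have h3 : (3 : ℝ) ≤ x := by exact_mod_cast hx
  have h2 : (16 : ℝ) ≤ 2 ^ q := by
    calc (16 : ℝ) = 2 ^ 4 := by norm_num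
      _ ≤ 2 ^ q := pow_le_pow_right₀ (by norm_num) hq
  have hX : (0 : ℝ) ≤ (x : ℝ) ^ q := by positivity
  have key : (0 : ℝ) ≤ 2 * (x - 2) * (2 ^ q * (x - 2) - (1 + x)) - 6 * (x - 1) := by
    have : (16 : ℝ) * (x - 2) ≤ 2 ^ q * (x - 2) :=
      mul_le_mul_of_nonneg_right h2 (by linarith)
    nlinarith
  have e : 3 * momentKernel 1 q x 1 + momentKernel 1 q x 2 =
      x * ((x : ℝ) ^ q * (2 * (x - 2) * (2 ^ q * (x - 2) - (1 + x)) - 6 * (x - 1)) +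
        6 * (x - 1) + 6 * (x - 2) * 2 ^ q) := by
    unfold momentKernel
    rw [one_pow]
    ring
  rw [e]
  have h4 : (0 : ℝ) ≤ x - 1 := by linarith
  have h5 : (0 : ℝ) ≤ x - 2 := by linarith
  have := mul_nonneg hX key
  positivity

lemma momentKernel_zero_right (ε : ℝ) (q : ℕ) (x : ℝ) : momentKernel ε q x 0 = 0 := by
  simp [momentKernel]

lemma momentKernel_one_one_nonpos (q x : ℕ) (hx : 1 ≤ x) : momentKernel 1 q x 1 ≤ 0 := by
  have h1 : (1 : ℝ) ≤ x := by exact_mod_cast hx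
  have h2 : (1 : ℝ) ≤ (x : ℝ) ^ q := one_le_pow₀ h1
  have e : momentKernel 1 q x 1 = -(x * (x - 1) * 2 * ((x : ℝ) ^ q - 1)) := by
    unfold momentKernel
    rw [one_pow]
    ring
  have h3 : (0 : ℝ) ≤ x - 1 := by linarith
  have h4 : (0 : ℝ) ≤ (x : ℝ) ^ q - 1 := by linarith
  rw [e, neg_nonpos]
  positivity

lemma sum_momentKernel_nonneg {ε : ℝ} (hε : ε = 1 ∨ ε = -1) {q : ℕ} (hq : ε = 1 → 4 ≤ q)
    {w : ℕ → ℝ} (hw : ∀ x, 0 < w x) (h12 : w 1 ≤ 3 * w 2) {N : ℕ} (hN : 3 ≤ N) :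
    0 ≤ ∑ y ∈ range N, w y * momentKernel ε q N y := by
  rcases hε with rfl | rfl
  · obtain ⟨M, rfl⟩ := Nat.exists_eq_add_of_le hN
    rw [sum_range_add, sum_range_succ, sum_range_succ, sum_range_one]
    refine add_nonneg ?_ (sum_nonneg fun y hy => mul_nonneg (hw _).le
      (momentKernel_one_nonneg _ _ _ (hq rfl) (by lia) (by have := mem_range.1 hy; lia)))
    have h1 := momentKernel_one_one_nonpos q (3 + M) (by lia)
    have h2 := momentKernel_one_one_add_two_nonneg q (3 + M) (hq rfl) (by lia)
    have h3 := mul_le_mul_of_nonpos_right h12 h1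
    have h4 := mul_nonneg (hw 2).le h2
    rw [Nat.cast_zero, Nat.cast_one, Nat.cast_two, momentKernel_zero_right]
    linarith
  · exact sum_nonneg fun y hy => mul_nonneg (hw _).le
      (momentKernel_neg_one_nonneg _ _ _ (mem_range.1 hy).le)

lemma momentForm_partialMoment_four_pos {ε : ℝ} (hε : ε = 1 ∨ ε = -1) {q : ℕ}
    (hq : ε = 1 → 4 ≤ q) {w : ℕ → ℝ} (hw : ∀ x, 0 < w x) (h12 : w 1 ≤ 3 * w 2)
    (h23 : w 2 ≤ 4 * w 3) : 0 < momentForm ε q (partialMoment w 4) := by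
  have e : momentForm ε q (partialMoment w 4) = w 2 * w 1 * momentKernel ε q 2 1 +
      w 3 * (w 1 * momentKernel ε q 3 1 + w 2 * momentKernel ε q 3 2) := by
    have h0 : momentForm ε q (partialMoment w 0) = 0 := by simp [momentForm, partialMoment]
    simp only [momentForm_partialMoment_succ, h0, sum_range_succ, sum_range_zero,
      Nat.cast_zero, Nat.cast_one, Nat.cast_ofNat, momentKernel_zero_right]
    ring
  have h1 := hw 1
  have h2 := hw 2
  have h3 := hw 3
  have p2 : (1 : ℝ) ≤ 2 ^ q := one_le_pow₀ (by norm_num)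
  have p23 : (2 : ℝ) ^ q ≤ 3 ^ q := by gcongr; norm_num
  rw [e]
  simp only [momentKernel, one_pow]
  rcases hε with rfl | rfl
  · have h16 : (16 : ℝ) ≤ 2 ^ q := by
      calc (16 : ℝ) = 2 ^ 4 := by norm_num
        _ ≤ 2 ^ q := pow_le_pow_right₀ (by norm_num) (hq rfl)
    have p6 : (16 : ℝ) * 3 ^ q ≤ 3 ^ q * 2 ^ q := by nlinarith
    have a1 : w 1 * w 2 * (2 ^ q - 1) ≤ 12 * (w 2 * w 3) * (2 ^ q - 1) := by
      refine mul_le_mul_of_nonneg_right ?_ (by linarith)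
      nlinarith
    have a2 : w 1 * w 3 * (3 ^ q - 1) ≤ 3 * (w 2 * w 3) * (3 ^ q - 1) := by
      refine mul_le_mul_of_nonneg_right ?_ (by linarith)
      nlinarith
    have a3 : 0 < w 2 * w 3 *
        (6 * (3 ^ q * 2 ^ q) - 24 * 3 ^ q + 18 * 2 ^ q - 36 * (3 ^ q - 1) - 48 * (2 ^ q - 1)) :=
      mul_pos (by positivity) (by linarith)
    linarith
  · have a1 : 0 < w 2 * w 1 * (2 * (2 ^ q + (2 ^ q * 3 - 2))) :=
      mul_pos (by positivity) (by linarith)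
    have a2 : 0 < w 3 * w 1 * (6 * (3 ^ q * 2 + (3 ^ q * 4 - 2))) :=
      mul_pos (by positivity) (by linarith)
    have a3 : 0 < w 3 * w 2 * (6 * (3 ^ q * 2 ^ q + (3 ^ q * 4 - 2 ^ q * 3))) :=
      mul_pos (by positivity) (by nlinarith)
    linarith

lemma momentForm_pos {ε : ℝ} (hε : ε = 1 ∨ ε = -1) {q : ℕ} (hq : ε = 1 → 4 ≤ q)
    {w : ℕ → ℝ} (hw : ∀ x, 0 < w x) (h12 : w 1 ≤ 3 * w 2) (h23 : w 2 ≤ 4 * w 3)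
    {m : ℕ → ℝ} (hm : ∀ k, HasSum (fun x : ℕ => (x : ℝ) ^ k * w x) (m k)) :
    0 < momentForm ε q m := by
  refine (momentForm_partialMoment_four_pos hε hq hw h12 h23).trans_le ?_
  have ht : ∀ k, Filter.Tendsto (fun N => partialMoment w N k) Filter.atTop (nhds (m k)) :=
    fun k => (hm k).tendsto_sum_nat
  have hlim : Filter.Tendsto (fun N => momentForm ε q (partialMoment w N)) Filter.atTop
      (nhds (momentForm ε q m)) :=
    (((ht _).mul (ht _)).sub ((ht _).pow 2)).add ((((((ht _).add (ht _)).mul (ht _)).sub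
      (((ht _).add (ht _)).mul (ht _)))).const_mul ε)
  refine ge_of_tendsto hlim ?_
  filter_upwards [Filter.eventually_ge_atTop 4] with N hN
  induction N, hN using Nat.le_induction with
  | base => exact le_rfl
  | succ N hN ih =>
    rw [momentForm_partialMoment_succ _ _ _ N]
    have := mul_nonneg (hw N).le (sum_momentKernel_nonneg hε hq hw h12 (by lia : 3 ≤ N))
    linarith

/-- An alternating sum of consecutive pair sums telescopes. -/
lemma alternating_sum_add_succ (m : ℕ → ℝ) (n : ℕ) :
    ∑ j ∈ Icc 1 n, (-1 : ℝ) ^ (j + 1) * (m (n + 1 - j) + m (n + 1 - j + 1)) =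
      m (n + 1) + (-1) ^ (n + 1) * m 1 := by
  have h : ∀ k ≤ n, ∑ j ∈ Icc 1 k, (-1 : ℝ) ^ (j + 1) * (m (n + 1 - j) + m (n + 1 - j + 1)) =
      m (n + 1) + (-1) ^ (k + 1) * m (n + 1 - k) := by
    intro k
    induction k with
    | zero => simp
    | succ k ih =>
      intro hk
      rw [sum_Icc_succ_top (by lia), ih (by lia), show n + 1 - (k + 1) + 1 = n + 1 - k by lia]
      ring
  simpa using h n le_rfl

lemma hasSum_binomial_bell (p k : ℕ) :
    HasSum (fun x : ℕ => (x : ℝ) ^ k * (1 + x) ^ p / x.factorial)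
      (Real.exp 1 * ∑ i ∈ range (p + 1), (p.choose i : ℝ) * bell (k + i)) := by
  have h := hasSum_sum (s := range (p + 1)) fun i _ =>
    (hasSum_pow_div_factorial (k + i)).mul_left (p.choose i : ℝ)
  convert! h using 1
  · funext x
    rw [add_comm (1 : ℝ), add_pow, mul_sum, sum_div]
    refine sum_congr rfl fun i _ => ?_
    rw [one_pow]
    ring
  · rw [mul_sum]
    exact sum_congr rfl fun i _ => by ring

/-- The sequence `∑ C(p,i) B_{k+i}`, up to the factor `e`, consists of the sums of consecutive
moments of the weight `(1 + x)^p / (x + 1)!`. -/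
lemma exists_moments_binomial_bell (p : ℕ) :
    ∃ m : ℕ → ℝ,
      (∀ k, HasSum (fun x : ℕ => (x : ℝ) ^ k * ((1 + x) ^ p / (x + 1).factorial)) (m k)) ∧
      ∀ k, Real.exp 1 * ∑ i ∈ range (p + 1), (p.choose i : ℝ) * bell (k + i) =
        m k + m (k + 1) := by
  have hs : ∀ k, Summable (fun x : ℕ => (x : ℝ) ^ k * ((1 + x) ^ p / (x + 1).factorial)) := by
    intro k
    refine (hasSum_binomial_bell p k).summable.of_nonneg_of_le (fun x => by positivity) fun x => ?_
    rw [← mul_div_assoc]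
    gcongr
    exact Nat.le_succ x
  refine ⟨_, fun k => (hs k).hasSum, fun k => (hasSum_binomial_bell p k).unique ?_⟩
  convert! (hs k).hasSum.add (hs (k + 1)).hasSum using 2 with x
  rw [Nat.factorial_succ]
  push_cast
  field_simp
  ring

/-- For all `n ≥ 5` and `p ≥ 0`,
`(∑ C(p,i) B_{n+i-1})(∑_{j=1}^{n-1} (-1)^{j+1} ∑ C(p,i) B_{n+i-j+1}) >
 (∑ C(p,i) B_{n+i})(∑_{j=1}^{n-1} (-1)^{j+1} ∑ C(p,i) B_{n+i-j})`. -/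
theorem stmt_17 (n p : ℕ) (hn : 5 ≤ n) :
    (∑ i ∈ Finset.range (p + 1), (p.choose i : ℤ) * bell (n + i - 1)) *
      (∑ j ∈ Finset.Icc 1 (n - 1), (-1 : ℤ) ^ (j + 1) *
        ∑ i ∈ Finset.range (p + 1), p.choose i * bell (n + i - j + 1)) >
    (∑ i ∈ Finset.range (p + 1), (p.choose i : ℤ) * bell (n + i)) *
      (∑ j ∈ Finset.Icc 1 (n - 1), (-1 : ℤ) ^ (j + 1) *
        ∑ i ∈ Finset.range (p + 1), p.choose i * bell (n + i - j)) := by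
  obtain ⟨q, rfl⟩ : ∃ q, n = q + 2 := ⟨n - 2, by lia⟩
  obtain ⟨m, hm, ha⟩ := exists_moments_binomial_bell p
  obtain ⟨a, ha_def⟩ : ∃ a : ℕ → ℝ,
      ∀ k, a k = ∑ i ∈ range (p + 1), (p.choose i : ℝ) * bell (k + i) := ⟨_, fun _ => rfl⟩
  simp only [← ha_def] at ha
  have hpos : 0 < momentForm ((-1) ^ q) q m := by
    refine momentForm_pos (neg_one_pow_eq_or ℝ q) (fun h => ?_) (fun x => by positivity) ?_ ?_ hm
    · by_contra hq
      obtain rfl : q = 3 := by lia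
      norm_num at h
    · have : (2 : ℝ) ^ p ≤ 3 ^ p := by gcongr; norm_num
      norm_num [Nat.factorial]
      linarith
    · have : (3 : ℝ) ^ p ≤ 4 ^ p := by gcongr; norm_num
      norm_num [Nat.factorial]
      linarith
  have hlow : Real.exp 1 * ∑ j ∈ Icc 1 (q + 1), (-1 : ℝ) ^ (j + 1) * a (q + 2 - j) =
      m (q + 2) + (-1) ^ q * m 1 := by
    have h := alternating_sum_add_succ m (q + 1)
    rw [show (-1 : ℝ) ^ (q + 1 + 1) = (-1) ^ q by ring] at h
    rw [← h, mul_sum]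
    exact sum_congr rfl fun j _ => by rw [← ha]; ring
  have hhigh : Real.exp 1 * ∑ j ∈ Icc 1 (q + 1), (-1 : ℝ) ^ (j + 1) * a (q + 2 - j + 1) =
      m (q + 3) + (-1) ^ q * m 2 := by
    have h := alternating_sum_add_succ (fun k => m (k + 1)) (q + 1)
    rw [show (-1 : ℝ) ^ (q + 1 + 1) = (-1) ^ q by ring] at h
    rw [← h, mul_sum]
    exact sum_congr rfl fun j _ => by rw [← ha]; ring
  have hmain : a (q + 2) * ∑ j ∈ Icc 1 (q + 1), (-1 : ℝ) ^ (j + 1) * a (q + 2 - j) <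
      a (q + 1) * ∑ j ∈ Icc 1 (q + 1), (-1 : ℝ) ^ (j + 1) * a (q + 2 - j + 1) := by
    refine lt_of_mul_lt_mul_left ?_ (by positivity : (0 : ℝ) ≤ Real.exp 1 * Real.exp 1)
    rw [mul_mul_mul_comm _ _ (a (q + 2)), mul_mul_mul_comm _ _ (a (q + 1)), ha, ha, hlow, hhigh]
    unfold momentForm at hpos
    linarith
  simp only [ha_def] at hmain
  have hhead : ∀ i, q + 2 + i - 1 = q + 1 + i := fun i => by lia
  have hidx : ∀ j ∈ Icc 1 (q + 1), ∀ i, q + 2 + i - j = q + 2 - j + i := by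
    intro j hj i
    have := mem_Icc.1 hj
    lia
  rw [gt_iff_lt, ← Int.cast_lt (R := ℝ)]
  push_cast
  simp only [hhead]
  refine (lt_of_eq_of_lt (congrArg _ (sum_congr rfl fun j hj => ?_)) hmain).trans_eq
    (congrArg _ (sum_congr rfl fun j hj => ?_))
  · simp only [hidx j hj]
  · simp only [hidx j hj, add_right_comm (q + 2 - j) 1]
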